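/- arXiv:1212.5356 — 3 statements merged into one kernel-verified Lean document; each statement's English description precedes it below -/
import Mathlib

section
/- Let P be a finite (3+1)-free poset. For every co-connected component S of the view poset v(P), the preimage v^{-1}(S) is a top of a tangle, a bottom of a tangle, or a clone set of P; conversely, every top of a tangle, every bottom of a tangle, and every clone set of P equals v^{-1}(S) for some co-connected component S of v(P). -/
/-- Two elements of a poset are incomparable. -/
def Incomp {β : Type*} [PartialOrder β] (x y : β) : Prop := ¬ x ≤ y ∧ ¬ y ≤ x

/-- A poset is `(3+1)`-free if it contains no induced subposet consisting of a
3-element chain together with an incomparable extra element. -/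
def ThreePlusOneFree (α : Type*) [PartialOrder α] : Prop :=
  ¬ ∃ a b c d : α, a < b ∧ b < c ∧ Incomp d a ∧ Incomp d b ∧ Incomp d c

variable {α : Type*} [PartialOrder α]

/-- The strict downset `D_a` of a vertex. -/
def Dset (a : α) : Set α := {x | x < a}

/-- The strict upset `U_a` of a vertex. -/
def Uset (a : α) : Set α := {x | a < x}

/-- `a ⊤⊤ b` : the strict downsets of `a` and `b` are incomparable under inclusion. -/
def TTrel (a b : α) : Prop := ¬ Dset a ⊆ Dset b ∧ ¬ Dset b ⊆ Dset a

/-- `a ⊥⊥ b` : the strict upsets of `a` and `b` are incomparable under inclusion. -/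
def BBrel (a b : α) : Prop := ¬ Uset a ⊆ Uset b ∧ ¬ Uset b ⊆ Uset a

/-- The view `v(a) = (D_a, P \ U_a)` of a vertex, an element of `Set α × Set α`
with the componentwise inclusion order; note `v(a) ≤ v(b) ↔ D_a ⊆ D_b ∧ U_b ⊆ U_a`. -/
def view (a : α) : Set α × Set α := (Dset a, (Uset a)ᶜ)

/-- A top of a tangle: a connected component, with at least two vertices, of the graph
on the vertices of `P` with edge relation `⊤⊤`. -/
def IsTopOfTangle (A : Set α) : Prop :=
  2 ≤ A.ncard ∧ ∃ a, A = {b | Relation.ReflTransGen TTrel a b}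

/-- A bottom of a tangle: a connected component, with at least two vertices, of the graph
on the vertices of `P` with edge relation `⊥⊥`. -/
def IsBottomOfTangle (B : Set α) : Prop :=
  2 ≤ B.ncard ∧ ∃ b, B = {a | Relation.ReflTransGen BBrel b a}

/-- A top of a tangle `A` and a bottom of a tangle `B` are matched when they contain the
top and bottom pairs of an induced `(2+2)` subposet. -/
def Matched (A B : Set α) : Prop :=
  ∃ a ∈ A, ∃ a' ∈ A, ∃ b ∈ B, ∃ b' ∈ B,
    b < a ∧ b' < a' ∧ Incomp a a' ∧ Incomp b b' ∧ Incomp a b' ∧ Incomp a' b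

/-- A tangle, regarded as a vertex set: the union of a matched top and bottom. -/
def IsTangle (X : Set α) : Prop :=
  ∃ A B : Set α, IsTopOfTangle A ∧ IsBottomOfTangle B ∧ Matched A B ∧ X = A ∪ B

/-- A vertex lying in no top of a tangle and no bottom of a tangle. -/
def NotInTanglePart (a : α) : Prop :=
  (∀ A : Set α, IsTopOfTangle A → a ∉ A) ∧ (∀ B : Set α, IsBottomOfTangle B → a ∉ B)

/-- A clone set: an equivalence class under "same view" of the vertices lying in no
top or bottom of a tangle. -/
def IsCloneSet (C : Set α) : Prop :=
  ∃ a : α, NotInTanglePart a ∧ C = {b | NotInTanglePart b ∧ view b = view a}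

/-- The parts of a `(3+1)`-free poset: its clone sets and its tangles. -/
def IsPart (X : Set α) : Prop := IsCloneSet X ∨ IsTangle X

/-- The level `ℓ(a)` of a vertex: the maximum number of elements in a chain of `P`
whose greatest element is `a`. -/
noncomputable def level (a : α) : ℕ :=
  sSup {n | ∃ s : Finset α, s.card = n ∧ IsChain (· ≤ ·) (↑s : Set α) ∧ a ∈ s ∧ ∀ x ∈ s, x ≤ a}

/-- A compatible listing of the parts of a `(3+1)`-free poset: an enumeration
`X_1, …, X_k` (each part listed exactly once) such that for vertices in distinct parts,
`a < b` holds exactly when `ℓ(a) ≤ ℓ(b) - 2`, or `ℓ(a) = ℓ(b) - 1` and `i < j`. -/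
noncomputable def CompatibleListing {k : ℕ} (X : Fin k → Set α) : Prop :=
  Function.Injective X ∧ (∀ Y : Set α, IsPart Y ↔ ∃ i, X i = Y) ∧
    ∀ i j : Fin k, i ≠ j → ∀ a ∈ X i, ∀ b ∈ X j,
      (a < b ↔ (level a + 2 ≤ level b ∨ (level a + 1 = level b ∧ i < j)))

/-- The incomparability relation on the view poset `v(P)` (the set of views of all
vertices, ordered componentwise): an edge joins two views lying in `v(P)` that are
incomparable. -/
def ViewIncompRel (α : Type*) [PartialOrder α] (p q : Set α × Set α) : Prop :=
  p ∈ Set.range (view : α → Set α × Set α) ∧ q ∈ Set.range (view : α → Set α × Set α) ∧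
    Incomp p q

/-- A co-connected component of the view poset `v(P)`: a connected component of the
incomparability graph of `v(P)`. -/
def IsCoComponent (α : Type*) [PartialOrder α] (S : Set (Set α × Set α)) : Prop :=
  ∃ p ∈ Set.range (view : α → Set α × Set α),
    S = {q | Relation.ReflTransGen (ViewIncompRel α) p q}

open Relation in
/-- The preimage under `view` of the co-connected component of `view a`. -/
def viewComponent (a : α) : Set α :=
  {b | ReflTransGen (ViewIncompRel α) (view a) (view b)}

theorem view_le_view_iff {a b : α} :
    view a ≤ view b ↔ Dset a ⊆ Dset b ∧ Uset b ⊆ Uset a := by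
  simp [view, Prod.le_def]

theorem TTrel.symm {a b : α} (h : TTrel a b) : TTrel b a := ⟨h.2, h.1⟩

theorem BBrel.symm {a b : α} (h : BBrel a b) : BBrel b a := ⟨h.2, h.1⟩

theorem Dset_eq_of_view_eq {a b : α} (h : view a = view b) : Dset a = Dset b :=
  congrArg Prod.fst h

theorem Uset_eq_of_view_eq {a b : α} (h : view a = view b) : Uset a = Uset b :=
  compl_injective (congrArg Prod.snd h)

theorem TTrel.congr_left {a b c : α} (hv : view b = view a) (h : TTrel a c) : TTrel b c := by
  unfold TTrel at *
  rwa [Dset_eq_of_view_eq hv]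

theorem BBrel.congr_left {a b c : α} (hv : view b = view a) (h : BBrel a c) : BBrel b c := by
  unfold BBrel at *
  rwa [Uset_eq_of_view_eq hv]

/-- Incomparable views come from incomparable downsets or incomparable upsets. -/
theorem ThreePlusOneFree.ttrel_or_bbrel (h : ThreePlusOneFree α) {a b : α}
    (hab : Incomp (view a) (view b)) : TTrel a b ∨ BBrel a b := by
  have key : ∀ {a b : α}, Dset a ⊆ Dset b → Uset a ⊆ Uset b →
      ¬ Dset b ⊆ Dset a → Uset b ⊆ Uset a := by
    intro a b hD hU hD'
    by_contra hU'
    obtain ⟨x, hxb, hxa⟩ := Set.not_subset.1 hD'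
    obtain ⟨y, hby, hay⟩ := Set.not_subset.1 hU'
    simp only [Dset, Uset, Set.mem_ofPred_eq] at hxb hxa hby hay
    have hnab : ¬ a < b := fun h' => lt_irrefl b (hU h')
    have hnba : ¬ b < a := fun h' => lt_irrefl b (hD h')
    have hne : a ≠ b := by rintro rfl; exact hxa hxb
    refine h ⟨x, b, y, a, hxb, hby, ⟨?_, ?_⟩, ⟨?_, ?_⟩, ⟨?_, ?_⟩⟩
    · exact fun h' => hnab (h'.trans_lt hxb)
    · intro h'
      rcases h'.lt_or_eq with h' | rfl
      exacts [hxa h', hnab hxb]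
    · exact fun h' => hnab (h'.lt_of_ne hne)
    · exact fun h' => hnba (h'.lt_of_ne hne.symm)
    · intro h'
      rcases h'.lt_or_eq with h' | rfl
      exacts [hay h', hnba hby]
    · exact fun h' => hnba (hby.trans_le h')
  have h₁ := @key a b
  have h₂ := @key b a
  simp only [Incomp, view_le_view_iff] at hab
  unfold TTrel BBrel
  tauto

theorem TTrel.incomp_view {a b : α} (h : TTrel a b) : Incomp (view a) (view b) :=
  ⟨fun h' => h.1 (view_le_view_iff.1 h').1, fun h' => h.2 (view_le_view_iff.1 h').1⟩

theorem BBrel.incomp_view {a b : α} (h : BBrel a b) : Incomp (view a) (view b) :=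
  ⟨fun h' => h.2 (view_le_view_iff.1 h').2, fun h' => h.1 (view_le_view_iff.1 h').2⟩

theorem TTrel.incomp {a b : α} (h : TTrel a b) : Incomp a b :=
  ⟨fun h' => h.1 fun _ hx => lt_of_lt_of_le hx h', fun h' => h.2 fun _ hx => lt_of_lt_of_le hx h'⟩

theorem BBrel.incomp {a b : α} (h : BBrel a b) : Incomp a b :=
  ⟨fun h' => h.2 fun _ hx => lt_of_le_of_lt h' hx, fun h' => h.1 fun _ hx => lt_of_le_of_lt h' hx⟩

/-- No vertex is incident both to a `⊤⊤` edge and to a `⊥⊥` edge. -/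
theorem ThreePlusOneFree.not_ttrel_and_bbrel (h : ThreePlusOneFree α) {a b c : α}
    (hab : TTrel a b) (hac : BBrel a c) : False := by
  have hiab := hab.incomp
  have hiac := hac.incomp
  obtain ⟨x, hxa, hxb⟩ := Set.not_subset.1 hab.1
  obtain ⟨y, hyb, hya⟩ := Set.not_subset.1 hab.2
  obtain ⟨z, haz, hcz⟩ := Set.not_subset.1 hac.1
  obtain ⟨w, hcw, haw⟩ := Set.not_subset.1 hac.2
  simp only [Dset, Uset, Set.mem_ofPred_eq] at hxa hxb hyb hya haz hcz hcw haw
  have hiaw : Incomp a w := by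
    refine ⟨fun h' => ?_, fun h' => hiac.2 (hcw.le.trans h')⟩
    rcases h'.lt_or_eq with h' | rfl
    exacts [haw h', hiac.2 hcw.le]
  have hiay : Incomp a y := by
    refine ⟨fun h' => hiab.1 (h'.trans hyb.le), fun h' => ?_⟩
    rcases h'.lt_or_eq with h' | rfl
    exacts [hya h', hiab.1 hyb.le]
  have hxc : x < c := by
    by_contra hxc
    refine h ⟨x, a, z, c, hxa, haz, ⟨fun h' => hiac.2 (h'.trans hxa.le), fun h' => ?_⟩,
      ⟨hiac.2, hiac.1⟩, ⟨fun h' => ?_, fun h' => hiac.1 (haz.le.trans h')⟩⟩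
    · rcases h'.lt_or_eq with h' | rfl
      exacts [hxc h', hiac.2 hxa.le]
    · rcases h'.lt_or_eq with h' | rfl
      exacts [hcz h', hiac.1 haz.le]
  have hibc : Incomp b c := by
    refine ⟨fun h' => ?_, fun h' => hxb (hxc.trans_le h')⟩
    rcases h'.lt_or_eq with h' | rfl
    exacts [h ⟨b, c, w, a, h', hcw, hiab, hiac, hiaw⟩, hxb hxc]
  have hbw : ¬ b < w := fun hbw => h ⟨y, b, w, a, hyb, hbw, hiay, hiab, hiaw⟩
  refine h ⟨x, c, w, b, hxc, hcw, ⟨fun h' => hiab.2 (h'.trans hxa.le), fun h' => ?_⟩, hibc,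
    ⟨fun h' => ?_, fun h' => hibc.2 (hcw.le.trans h')⟩⟩
  · rcases h'.lt_or_eq with h' | rfl
    exacts [hxb h', hiab.2 hxa.le]
  · rcases h'.lt_or_eq with h' | rfl
    exacts [hbw h', hibc.2 hcw.le]

open Relation in
/-- If the relation `R` accounts for every view incomparability at a vertex of an `R` edge, then
the `R` component of such a vertex is the preimage of a co-connected component. -/
theorem reflTransGen_eq_viewComponent {R : α → α → Prop}
    (symm : ∀ {a b}, R a b → R b a)
    (congr_left : ∀ {a b c}, view b = view a → R a c → R b c)
    (incomp_view : ∀ {a b}, R a b → Incomp (view a) (view b))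
    (of_incomp_view : ∀ {a b c}, R a b → Incomp (view a) (view c) → R a c)
    {a b : α} (hab : R a b) : {c | ReflTransGen R a c} = viewComponent a := by
  refine Set.Subset.antisymm
    (fun c hc => hc.lift view fun x y hxy => ⟨⟨x, rfl⟩, ⟨y, rfl⟩, incomp_view hxy⟩) ?_
  suffices H : ∀ q, ReflTransGen (ViewIncompRel α) (view a) q →
      ∀ c, view c = q → ReflTransGen R a c ∧ ∃ d, R c d from fun c hc => (H _ hc c rfl).1
  intro q hq
  induction hq with
  | refl =>
    intro c hc
    have hcb := congr_left hc hab
    exact ⟨.tail (.single hab) (symm hcb), b, hcb⟩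
  | tail _ hstep ih =>
    rintro c rfl
    obtain ⟨⟨e, rfl⟩, -, hec⟩ := hstep
    obtain ⟨hae, d, hed⟩ := ih e rfl
    have hec := of_incomp_view hed hec
    exact ⟨hae.tail hec, e, symm hec⟩

theorem ThreePlusOneFree.reflTransGen_ttrel_eq (h : ThreePlusOneFree α) {a b : α}
    (hab : TTrel a b) : {c | Relation.ReflTransGen TTrel a c} = viewComponent a :=
  reflTransGen_eq_viewComponent TTrel.symm TTrel.congr_left TTrel.incomp_view
    (fun h₁ h₂ => (h.ttrel_or_bbrel h₂).resolve_right (h.not_ttrel_and_bbrel h₁)) hab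

theorem ThreePlusOneFree.reflTransGen_bbrel_eq (h : ThreePlusOneFree α) {a b : α}
    (hab : BBrel a b) : {c | Relation.ReflTransGen BBrel a c} = viewComponent a :=
  reflTransGen_eq_viewComponent BBrel.symm BBrel.congr_left BBrel.incomp_view
    (fun h₁ h₂ => (h.ttrel_or_bbrel h₂).resolve_left fun h₃ => h.not_ttrel_and_bbrel h₃ h₁) hab

open Relation in
theorem exists_rel_of_two_le_ncard {β : Type*} {R : β → β → Prop} {a : β}
    (h : 2 ≤ {b | ReflTransGen R a b}.ncard) : ∃ b, R a b := by
  obtain ⟨b, hb, hne⟩ := Set.exists_ne_of_one_lt_ncard h a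
  rcases ReflTransGen.cases_head hb with rfl | ⟨c, hc, -⟩
  exacts [absurd rfl hne, ⟨c, hc⟩]

open Relation in
theorem two_le_ncard_of_rel {β : Type*} [Finite β] {R : β → β → Prop} {a b : β}
    (hab : R a b) (hne : a ≠ b) : 2 ≤ {c | ReflTransGen R a c}.ncard :=
  (Set.one_lt_ncard (Set.toFinite _)).2 ⟨a, .refl, b, .single hab, hne⟩

theorem TTrel.isTopOfTangle [Finite α] {a b : α} (hab : TTrel a b) :
    IsTopOfTangle {c | Relation.ReflTransGen TTrel a c} :=
  ⟨two_le_ncard_of_rel hab fun hne => hab.incomp.1 hne.le, a, rfl⟩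

theorem BBrel.isBottomOfTangle [Finite α] {a b : α} (hab : BBrel a b) :
    IsBottomOfTangle {c | Relation.ReflTransGen BBrel a c} :=
  ⟨two_le_ncard_of_rel hab fun hne => hab.incomp.1 hne.le, a, rfl⟩

open Relation in
theorem exists_rel_of_mem_component {β : Type*} {R : β → β → Prop}
    (symm : ∀ {a b}, R a b → R b a) {a b : β} (h : 2 ≤ {c | ReflTransGen R a c}.ncard)
    (hb : ReflTransGen R a b) : ∃ c, R b c := by
  rcases ReflTransGen.cases_tail hb with rfl | ⟨c, -, hc⟩
  exacts [exists_rel_of_two_le_ncard h, ⟨c, symm hc⟩]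

theorem notInTanglePart_iff [Finite α] {a : α} :
    NotInTanglePart a ↔ (∀ b, ¬ TTrel a b) ∧ ∀ b, ¬ BBrel a b := by
  refine ⟨fun h => ⟨fun b hab => h.1 _ hab.isTopOfTangle .refl,
    fun b hab => h.2 _ hab.isBottomOfTangle .refl⟩, fun h => ⟨?_, ?_⟩⟩
  · rintro _ ⟨hcard, c, rfl⟩ hca
    obtain ⟨d, hd⟩ := exists_rel_of_mem_component TTrel.symm hcard hca
    exact h.1 d hd
  · rintro _ ⟨hcard, c, rfl⟩ hca
    obtain ⟨d, hd⟩ := exists_rel_of_mem_component BBrel.symm hcard hca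
    exact h.2 d hd

theorem NotInTanglePart.congr [Finite α] {a b : α} (hv : view b = view a)
    (ha : NotInTanglePart a) : NotInTanglePart b := by
  rw [notInTanglePart_iff] at *
  exact ⟨fun c hc => ha.1 c (hc.congr_left hv.symm), fun c hc => ha.2 c (hc.congr_left hv.symm)⟩

theorem ThreePlusOneFree.cloneSet_eq [Finite α] (h : ThreePlusOneFree α) {a : α}
    (ha : NotInTanglePart a) : {b | NotInTanglePart b ∧ view b = view a} = viewComponent a := by
  ext b
  constructor
  · rintro ⟨-, hb⟩
    change Relation.ReflTransGen (ViewIncompRel α) (view a) (view b)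
    rw [hb]
  · intro hb
    have hba : view b = view a := by
      rcases Relation.ReflTransGen.cases_head hb with hb | ⟨_, ⟨-, ⟨c, rfl⟩, hc⟩, -⟩
      · exact hb.symm
      · have hna := notInTanglePart_iff.1 ha
        exact ((h.ttrel_or_bbrel hc).elim (hna.1 c) (hna.2 c)).elim
    exact ⟨ha.congr hba, hba⟩

/-- In a finite `(3+1)`-free poset `P`, the preimages under the view
map of the co-connected components of `v(P)` are exactly the tops of tangles, bottoms of
tangles, and clone sets of `P`. -/
theorem cocomponent_preimages {α : Type*} [Fintype α] [PartialOrder α]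
    (h : ThreePlusOneFree α) :
    (∀ S : Set (Set α × Set α), IsCoComponent α S →
      IsTopOfTangle ((view : α → Set α × Set α) ⁻¹' S) ∨
      IsBottomOfTangle ((view : α → Set α × Set α) ⁻¹' S) ∨
      IsCloneSet ((view : α → Set α × Set α) ⁻¹' S)) ∧
    (∀ X : Set α, (IsTopOfTangle X ∨ IsBottomOfTangle X ∨ IsCloneSet X) →
      ∃ S : Set (Set α × Set α), IsCoComponent α S ∧
        X = (view : α → Set α × Set α) ⁻¹' S) := by
  constructor
  · rintro _ ⟨_, ⟨a, rfl⟩, rfl⟩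
    change IsTopOfTangle (viewComponent a) ∨ IsBottomOfTangle (viewComponent a) ∨
      IsCloneSet (viewComponent a)
    by_cases hT : ∃ b, TTrel a b
    · obtain ⟨b, hab⟩ := hT
      exact .inl (h.reflTransGen_ttrel_eq hab ▸ hab.isTopOfTangle)
    by_cases hB : ∃ b, BBrel a b
    · obtain ⟨b, hab⟩ := hB
      exact .inr (.inl (h.reflTransGen_bbrel_eq hab ▸ hab.isBottomOfTangle))
    have ha : NotInTanglePart a := notInTanglePart_iff.2 ⟨not_exists.1 hT, not_exists.1 hB⟩
    exact .inr (.inr ⟨a, ha, (h.cloneSet_eq ha).symm⟩)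
  · intro X hX
    suffices H : ∃ a, X = viewComponent a by
      obtain ⟨a, rfl⟩ := H
      exact ⟨_, ⟨view a, ⟨a, rfl⟩, rfl⟩, rfl⟩
    rcases hX with ⟨hcard, a, rfl⟩ | ⟨hcard, a, rfl⟩ | ⟨a, ha, rfl⟩
    · obtain ⟨b, hab⟩ := exists_rel_of_two_le_ncard hcard
      exact ⟨a, h.reflTransGen_ttrel_eq hab⟩
    · obtain ⟨b, hab⟩ := exists_rel_of_two_le_ncard hcard
      exact ⟨a, h.reflTransGen_bbrel_eq hab⟩
    · exact ⟨a, h.cloneSet_eq ha⟩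
end

section
/- Let P be a finite poset such that for any two vertices a, b with ℓ(a) ≤ ℓ(b) − 2 we have a < b. Then P is (3+1)-free if and only if for any two vertices c, d with ℓ(c) = ℓ(d), we have U_c ⊆ U_d or D_c ⊆ D_d. -/
variable {α : Type*} [PartialOrder α]

theorem level_strictMono {β : Type*} [Finite β] [PartialOrder β] :
    StrictMono (level : β → ℕ) := by
  classical
  have := Fintype.ofFinite β
  have hbdd : ∀ a : β, BddAbove {n | ∃ s : Finset β, s.card = n ∧
      IsChain (· ≤ ·) (↑s : Set β) ∧ a ∈ s ∧ ∀ x ∈ s, x ≤ a} := by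
    intro a
    refine ⟨Fintype.card β, ?_⟩
    rintro n ⟨s, rfl, -⟩
    exact s.card_le_univ
  intro a b hab
  have hne : {n | ∃ s : Finset β, s.card = n ∧
      IsChain (· ≤ ·) (↑s : Set β) ∧ a ∈ s ∧ ∀ x ∈ s, x ≤ a}.Nonempty :=
    ⟨1, {a}, by simp, by simp, by simp, by simp⟩
  obtain ⟨s, hs, hchain, -, hle⟩ := Nat.sSup_mem hne (hbdd a)
  have hb : b ∉ s := fun hb => (hle b hb).not_gt hab
  refine Nat.lt_of_succ_le (le_csSup (hbdd b) ⟨insert b s, ?_, ?_, ?_, ?_⟩)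
  · rw [Finset.card_insert_of_notMem hb, hs]
    rfl
  · rw [Finset.coe_insert]
    exact hchain.insert fun x hx _ => Or.inr ((hle x hx).trans hab.le)
  · exact Finset.mem_insert_self b s
  · intro x hx
    rcases Finset.mem_insert.mp hx with rfl | hx
    · exact le_rfl
    · exact (hle x hx).trans hab.le

/-- Let `P` be a finite poset in which `ℓ(a) ≤ ℓ(b) - 2` implies
`a < b`. Then `P` is `(3+1)`-free if and only if any two vertices `c, d` on the same
level satisfy `U_c ⊆ U_d` or `D_c ⊆ D_d`. -/
theorem threePlusOneFree_iff_nested_on_levels {α : Type*} [Fintype α] [PartialOrder α]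
    (h : ∀ a b : α, level a + 2 ≤ level b → a < b) :
    ThreePlusOneFree α ↔
      ∀ c d : α, level c = level d → (Uset c ⊆ Uset d ∨ Dset c ⊆ Dset d) := by
  constructor
  · intro hfree c d hcd
    by_contra! hne
    obtain ⟨x, hcx, hdx⟩ := Set.not_subset.mp hne.1
    obtain ⟨y, hyc, hyd⟩ := Set.not_subset.mp hne.2
    simp only [Uset, Dset, Set.mem_ofPred_eq] at hcx hdx hyc hyd
    have hncd : ¬ c < d := fun hlt => (level_strictMono hlt).ne hcd
    have hndc : ¬ d < c := fun hlt => (level_strictMono hlt).ne' hcd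
    have hne' : c ≠ d := fun heq => hdx (heq ▸ hcx)
    refine hfree ⟨y, c, x, d, hyc, hcx, ⟨?_, ?_⟩, ⟨?_, ?_⟩, ⟨?_, ?_⟩⟩
    · exact fun hle => hndc (hle.trans_lt hyc)
    · exact fun hle => hle.lt_or_eq.elim hyd fun heq => hndc (heq ▸ hyc)
    · exact fun hle => hndc (hle.lt_of_ne hne'.symm)
    · exact fun hle => hncd (hle.lt_of_ne hne')
    · exact fun hle => hle.lt_or_eq.elim hdx fun heq => hncd (heq ▸ hcx)
    · exact fun hle => hncd (hcx.trans_le hle)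
  · rintro hnested ⟨a, b, c, d, hab, hbc, hda, -, hdc⟩
    have hlab := level_strictMono hab
    have hlbc := level_strictMono hbc
    have hlad : ¬ level a + 2 ≤ level d := fun hl => hda.2 (h a d hl).le
    have hldc : ¬ level d + 2 ≤ level c := fun hl => hdc.1 (h d c hl).le
    rcases hnested b d (by omega) with hU | hD
    · exact hdc.1 (hU hbc).le
    · exact hda.2 (hD hab).le
end

section
/- Let P be a finite (3+1)-free poset and suppose a, b, c, d are distinct vertices inducing a (2+2) subposet of P, i.e. a < b, c < d, and the pairs (a,c), (a,d), (b,c), (b,d) are each incomparable. Then there is an integer m with ℓ(a) = ℓ(c) = m and ℓ(b) = ℓ(d) = m + 1; in particular, every induced (2+2) subposet of P is contained in two adjacent levels of P. -/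
variable {α : Type*} [PartialOrder α]

theorem card_le_level {α : Type*} [Fintype α] [PartialOrder α] {a : α} {s : Finset α}
    (hs : IsChain (· ≤ ·) (↑s : Set α)) (ha : a ∈ s) (hle : ∀ x ∈ s, x ≤ a) :
    s.card ≤ level a := by
  refine le_csSup ⟨Fintype.card α, ?_⟩ ⟨s, rfl, hs, ha, hle⟩
  rintro n ⟨t, rfl, -⟩
  exact Finset.card_le_univ t

theorem one_le_level {α : Type*} [Fintype α] [PartialOrder α] (a : α) : 1 ≤ level a := by
  simpa using card_le_level (a := a) (s := {a}) (by simp) (by simp) (by simp)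

theorem exists_chain_card_eq_level {α : Type*} [Fintype α] [PartialOrder α] (a : α) :
    ∃ s : Finset α, s.card = level a ∧ IsChain (· ≤ ·) (↑s : Set α) ∧ a ∈ s ∧
      ∀ x ∈ s, x ≤ a := by
  refine Nat.sSup_mem (s := {n | ∃ s : Finset α, s.card = n ∧
    IsChain (· ≤ ·) (↑s : Set α) ∧ a ∈ s ∧ ∀ x ∈ s, x ≤ a}) ?_ ⟨Fintype.card α, ?_⟩
  · exact ⟨1, {a}, by simp⟩
  · rintro n ⟨t, rfl, -⟩
    exact Finset.card_le_univ t

theorem level_lt_level {α : Type*} [Fintype α] [PartialOrder α] {a b : α} (hab : a < b) :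
    level a < level b := by
  classical
  obtain ⟨s, hcard, hs, -, hle⟩ := exists_chain_card_eq_level a
  have hlt : ∀ x ∈ s, x < b := fun x hx => (hle x hx).trans_lt hab
  have hb : b ∉ s := fun hb => (hlt b hb).false
  have key : (insert b s).card ≤ level b := by
    refine card_le_level ?_ (Finset.mem_insert_self b s) ?_
    · rw [Finset.coe_insert]
      exact hs.insert fun x hx _ => Or.inr (hlt x hx).le
    · intro x hx
      rcases Finset.mem_insert.1 hx with rfl | hx
      exacts [le_rfl, (hlt x hx).le]
  rw [Finset.card_insert_of_notMem hb] at key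
  omega

/-- A vertex of level greater than one lies above a vertex of the preceding level. -/
theorem exists_lt_level_le_succ {α : Type*} [Fintype α] [PartialOrder α] {a : α}
    (ha : 1 < level a) : ∃ z < a, level a ≤ level z + 1 := by
  classical
  obtain ⟨s, hcard, hs, has, hle⟩ := exists_chain_card_eq_level a
  have herase : (s.erase a).card = level a - 1 := by rw [Finset.card_erase_of_mem has, hcard]
  have hne : (s.erase a).Nonempty := Finset.card_pos.1 (by omega)
  obtain ⟨z, hz⟩ := (s.erase a).exists_maximal hne
  have hzs := Finset.mem_erase.1 hz.prop
  refine ⟨z, lt_of_le_of_ne (hle z hzs.2) hzs.1, ?_⟩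
  have key : (s.erase a).card ≤ level z := by
    refine card_le_level (hs.mono (by simp)) hz.prop fun x hx => ?_
    rcases hs.total (Finset.mem_of_mem_erase hx) hzs.2 with h | h
    exacts [h, hz.le_of_ge hx h]
  omega

theorem level_mono_of_Dset_subset {α : Type*} [Fintype α] [PartialOrder α] {a c : α}
    (hac : Dset a ⊆ Dset c) : level a ≤ level c := by
  by_cases ha : 1 < level a
  · obtain ⟨z, hz, hle⟩ := exists_lt_level_le_succ ha
    have := level_lt_level (show z < c from hac hz)
    omega
  · have := one_le_level c
    omega

/-- In a `(3+1)`-free poset, a vertex incomparable to the top of a 3-element chain lies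
above its bottom. -/
theorem ThreePlusOneFree.lt_of_lt_of_lt_of_incomp {α : Type*} [PartialOrder α] (h : ThreePlusOneFree α)
    {x y z w : α} (hxy : x < y) (hyz : y < z) (hwz : Incomp w z) : x < w := by
  by_contra hxw
  have hw : ∀ u < z, ¬ w ≤ u := fun u hu hwu => hwz.1 (hwu.trans hu.le)
  have hxw' : ¬ x ≤ w := fun hle =>
    hxw (lt_of_le_of_ne hle fun he => hw x (hxy.trans hyz) he.symm.le)
  exact h ⟨x, y, z, w, hxy, hyz, ⟨hw x (hxy.trans hyz), hxw'⟩,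
    ⟨hw y hyz, fun hyw => hxw' (hxy.le.trans hyw)⟩, hwz⟩

theorem ThreePlusOneFree.level_le_of_incomp {α : Type*} [Fintype α] [PartialOrder α]
    (h : ThreePlusOneFree α) {b c : α} (hbc : Incomp c b) : level b ≤ level c + 1 := by
  by_contra! hlt
  have hc := one_le_level c
  obtain ⟨y, hy, hyb⟩ := exists_lt_level_le_succ (a := b) (by omega)
  obtain ⟨z, hz, hzy⟩ := exists_lt_level_le_succ (a := y) (by omega)
  have := level_lt_level (h.lt_of_lt_of_lt_of_incomp hz hy hbc)
  omega

/-- In a finite `(3+1)`-free poset, every induced `(2+2)` subposet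
(with `a < b`, `c < d`, and all cross pairs incomparable) is contained in two adjacent
levels: there is `m` with `ℓ(a) = ℓ(c) = m` and `ℓ(b) = ℓ(d) = m + 1`. -/
theorem two_plus_two_in_adjacent_levels {α : Type*} [Fintype α] [PartialOrder α]
    (h : ThreePlusOneFree α) (a b c d : α)
    (hd1 : a ≠ b) (hd2 : a ≠ c) (hd3 : a ≠ d) (hd4 : b ≠ c) (hd5 : b ≠ d) (hd6 : c ≠ d)
    (hab : a < b) (hcd : c < d)
    (h1 : Incomp a c) (h2 : Incomp a d) (h3 : Incomp b c) (h4 : Incomp b d) :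
    ∃ m : ℕ, level a = m ∧ level c = m ∧ level b = m + 1 ∧ level d = m + 1 := by
  have hac : level a ≤ level c :=
    level_mono_of_Dset_subset fun _ hx => h.lt_of_lt_of_lt_of_incomp hx hab (And.symm h3)
  have hca : level c ≤ level a :=
    level_mono_of_Dset_subset fun _ hx => h.lt_of_lt_of_lt_of_incomp hx hcd h2
  have hb := h.level_le_of_incomp (And.symm h3)
  have hd := h.level_le_of_incomp h2
  have hab' := level_lt_level hab
  have hcd' := level_lt_level hcd
  exact ⟨level a, rfl, by omega, by omega, by omega⟩
end
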